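/- There exist a constant c > 0 and a threshold N₀ such that for every finite abelian group G with |G| = n ≥ N₀ and every ε ∈ G with ε² = 1, the following holds. Let Aut(G, ε) = {f ∈ Aut(G) : f(ε) = ε} act on subsets of G³ componentwise. Then the number of Aut(G, ε)-orbits of symmetric subsets S that are hyperfield-defining with respect to ε and satisfy f(S) = S for some non-identity f ∈ Aut(G, ε) is at most e^{−cn²} times the number of Aut(G, ε)-orbits of all symmetric subsets hyperfield-defining with respect to ε. -/

import Mathlib

/-- A subset `S ⊆ G³` is symmetric if it is closed under all permutations of the three
coordinates (swap and cycle generate `S₃`) and under the diagonal left-multiplication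
action of `G`. -/
def IsSymmetric {G : Type*} [CommGroup G] (S : Set (G × G × G)) : Prop :=
  (∀ x y z : G, (x, y, z) ∈ S → (y, x, z) ∈ S) ∧
  (∀ x y z : G, (x, y, z) ∈ S → (y, z, x) ∈ S) ∧
  (∀ g x y z : G, (x, y, z) ∈ S → (g * x, g * y, g * z) ∈ S)

/-- A hexagon of an abelian group `G` is an orbit of `G³` under the combined action of
`G` (diagonal multiplication) and `S₃` (permutation of coordinates).
`hexRel v w` says that `w` lies in the orbit of `v`. -/
def hexRel {G : Type*} [CommGroup G] (v w : G × G × G) : Prop :=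
  ∃ g : G, w = (g * v.1, g * v.2.1, g * v.2.2) ∨ w = (g * v.1, g * v.2.2, g * v.2.1) ∨
    w = (g * v.2.1, g * v.1, g * v.2.2) ∨ w = (g * v.2.1, g * v.2.2, g * v.1) ∨
    w = (g * v.2.2, g * v.1, g * v.2.1) ∨ w = (g * v.2.2, g * v.2.1, g * v.1)

/-- A subset of `G³` is a hexagon if it is the orbit of some triple. -/
def IsHexagon {G : Type*} [CommGroup G] (H : Set (G × G × G)) : Prop :=
  ∃ v : G × G × G, H = {w | hexRel v w}

/-- The number of hexagons of `G`. -/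
noncomputable def numHexagons (G : Type*) [CommGroup G] : ℕ :=
  Nat.card {H : Set (G × G × G) // IsHexagon H}

/-- Condition (A) w.r.t. `ε`. -/
def CondA {G : Type*} [CommGroup G] (ε : G) (S : Set (G × G × G)) : Prop :=
  ∀ x : G, x ≠ ε → ∃ y : G, (x, y, 1) ∈ S

/-- Condition (B) w.r.t. `ε`. -/
def CondB {G : Type*} [CommGroup G] (ε : G) (S : Set (G × G × G)) : Prop :=
  ∀ x y z w : G, (x, y, 1) ∈ S → (z, w, 1) ∈ S → (x, y) ≠ (z, w) →
    ∃ t : G, (t * x, ε * t * z, 1) ∈ S ∧ (ε * t * y, t * w, 1) ∈ S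

/-- The componentwise action of a map `f : G → G` on triples. -/
def tripleMap {G : Type*} (f : G → G) (v : G × G × G) : G × G × G :=
  (f v.1, f v.2.1, f v.2.2)

/-- The relation identifying two subsets of `G³` (within the collection of those
satisfying `P`) when some `ε`-preserving automorphism of `G` maps one onto the other. -/
def autRel {G : Type*} [CommGroup G] (ε : G) (P : Set (G × G × G) → Prop)
    (S T : {S : Set (G × G × G) // P S}) : Prop :=
  ∃ f : G ≃* G, f ε = ε ∧ tripleMap f '' S.1 = T.1

/-- The number of `Aut(G, ε)`-orbits of subsets of `G³` satisfying `P`. -/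
noncomputable def numOrbits {G : Type*} [CommGroup G] (ε : G)
    (P : Set (G × G × G) → Prop) : ℕ :=
  Nat.card (Quot (autRel ε P))

section Hexagons

variable {G : Type*} [CommGroup G]

/-- Two triples are related when no symmetric set separates them; the classes are the hexagons. -/
def hexSetoid (G : Type*) [CommGroup G] : Setoid (G × G × G) where
  r v w := ∀ S : Set (G × G × G), IsSymmetric S → (v ∈ S ↔ w ∈ S)
  iseqv := ⟨fun _ _ _ => Iff.rfl, fun h S hS => (h S hS).symm,
    fun h₁ h₂ S hS => (h₁ S hS).trans (h₂ S hS)⟩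

/-- The type of hexagons, as a quotient of the set of triples. -/
abbrev Hex (G : Type*) [CommGroup G] : Type _ := Quotient (hexSetoid G)

/-- The hexagon of a triple. -/
def toHex (v : G × G × G) : Hex G := Quotient.mk (hexSetoid G) v

lemma toHex_eq_iff {v w : G × G × G} :
    toHex v = toHex w ↔ ∀ S : Set (G × G × G), IsSymmetric S → (v ∈ S ↔ w ∈ S) :=
  ⟨fun h => Quotient.exact h, fun h => Quotient.sound h⟩

lemma toHex_swap (x y z : G) : toHex (y, x, z) = toHex (x, y, z) :=
  toHex_eq_iff.2 fun _ hS => ⟨hS.1 _ _ _, hS.1 _ _ _⟩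

lemma toHex_rotate (x y z : G) : toHex (y, z, x) = toHex (x, y, z) :=
  toHex_eq_iff.2 fun _ hS => ⟨fun h => hS.2.1 _ _ _ (hS.2.1 _ _ _ h), hS.2.1 _ _ _⟩

lemma toHex_mul (g x y z : G) : toHex (g * x, g * y, g * z) = toHex (x, y, z) :=
  toHex_eq_iff.2 fun _ hS =>
    ⟨fun h => by simpa using hS.2.2 g⁻¹ _ _ _ h, hS.2.2 _ _ _ _⟩

lemma isSymmetric_preimage (T : Set (Hex G)) : IsSymmetric (toHex ⁻¹' T) := by
  refine ⟨fun x y z h => ?_, fun x y z h => ?_, fun g x y z h => ?_⟩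
  · simpa [toHex_swap] using h
  · simpa [toHex_rotate] using h
  · simpa [toHex_mul] using h

lemma toHex_mem_image {S : Set (G × G × G)} (hS : IsSymmetric S) (v : G × G × G) :
    toHex v ∈ toHex '' S ↔ v ∈ S :=
  ⟨fun ⟨_, hw, h⟩ => (toHex_eq_iff.1 h S hS).1 hw, fun h => ⟨v, h, rfl⟩⟩

lemma isSymmetric_hexRel (v : G × G × G) : IsSymmetric {w | hexRel v w} := by
  refine ⟨?_, ?_, ?_⟩
  · rintro x y z ⟨g, h⟩
    refine ⟨g, ?_⟩
    simp only [Prod.mk.injEq] at h ⊢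
    tauto
  · rintro x y z ⟨g, h⟩
    refine ⟨g, ?_⟩
    simp only [Prod.mk.injEq] at h ⊢
    tauto
  · rintro k x y z ⟨g, h⟩
    refine ⟨k * g, ?_⟩
    simp only [Prod.mk.injEq, mul_assoc, mul_right_inj] at h ⊢
    exact h

lemma hexRel_of_toHex_eq {v w : G × G × G} (h : toHex v = toHex w) : hexRel v w :=
  (toHex_eq_iff.1 h _ (isSymmetric_hexRel v)).1 ⟨1, Or.inl (by simp)⟩

lemma hexRel_one_cases {a b x y : G} (h : hexRel (a, b, 1) (x, y, 1)) :
    (x, y) = (a, b) ∨ (x, y) = (b, a) ∨ (x, y) = (b⁻¹ * a, b⁻¹) ∨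
      (x, y) = (b⁻¹, b⁻¹ * a) ∨ (x, y) = (a⁻¹ * b, a⁻¹) ∨ (x, y) = (a⁻¹, a⁻¹ * b) := by
  obtain ⟨g, h⟩ := h
  simp only [Prod.mk.injEq, mul_one] at h ⊢
  rcases h with ⟨rfl, rfl, h⟩ | ⟨rfl, rfl, h⟩ | ⟨rfl, rfl, h⟩ | ⟨rfl, rfl, h⟩ | ⟨rfl, rfl, h⟩ |
    ⟨rfl, rfl, h⟩
  all_goals first
    | (obtain rfl := h; simp)
    | (obtain rfl := eq_inv_of_mul_eq_one_left h.symm; simp)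

lemma isSymmetric_preimage_tripleMap (f : G ≃* G) {S : Set (G × G × G)} (hS : IsSymmetric S) :
    IsSymmetric (tripleMap f ⁻¹' S) := by
  refine ⟨fun x y z h => hS.1 _ _ _ h, fun x y z h => hS.2.1 _ _ _ h, fun g x y z h => ?_⟩
  simpa [tripleMap] using hS.2.2 (f g) _ _ _ h

lemma toHex_tripleMap_eq (f : G ≃* G) {v w : G × G × G} (h : toHex v = toHex w) :
    toHex (tripleMap f v) = toHex (tripleMap f w) :=
  toHex_eq_iff.2 fun _ hS => toHex_eq_iff.1 h _ (isSymmetric_preimage_tripleMap f hS)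

/-- The permutation of the hexagons induced by an automorphism. -/
def hexPerm (f : G ≃* G) : Equiv.Perm (Hex G) where
  toFun := Quotient.map (tripleMap f) fun _ _ h =>
    Quotient.exact (toHex_tripleMap_eq f (Quotient.sound h))
  invFun := Quotient.map (tripleMap f.symm) fun _ _ h =>
    Quotient.exact (toHex_tripleMap_eq f.symm (Quotient.sound h))
  left_inv q := by
    induction q using Quotient.inductionOn with
    | h v => simp [tripleMap]
  right_inv q := by
    induction q using Quotient.inductionOn with
    | h v => simp [tripleMap]

lemma hexPerm_toHex (f : G ≃* G) (v : G × G × G) :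
    hexPerm f (toHex v) = toHex (tripleMap f v) := rfl

lemma toHex_surjective : Function.Surjective (toHex : G × G × G → Hex G) :=
  Quotient.mk_surjective

end Hexagons

section InvariantSets

variable {X : Type*} [Fintype X] [DecidableEq X]

lemma exists_disjoint_image (σ : Equiv.Perm X) :
    ∃ D : Finset X, (∀ x ∈ D, σ x ∉ D) ∧ (Finset.univ.filter fun x => σ x ≠ x).card ≤ 3 * D.card := by
  classical
  obtain ⟨D, hD, hmax⟩ := Finset.exists_max_image
    (Finset.univ.filter fun D : Finset X => ∀ x ∈ D, σ x ∉ D) Finset.card ⟨∅, by simp⟩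
  simp only [Finset.mem_filter, Finset.mem_univ, true_and] at hD hmax
  refine ⟨D, hD, ?_⟩
  have hsub : (Finset.univ.filter fun x => σ x ≠ x) ⊆ D ∪ D.image σ ∪ D.image σ.symm := by
    intro x hx
    by_contra hcon
    simp only [Finset.mem_filter, Finset.mem_univ, true_and, Finset.mem_union, Finset.mem_image,
      not_or, not_exists, not_and] at hx hcon
    obtain ⟨⟨h₁, h₂⟩, h₃⟩ := hcon
    have h := hmax (insert x D) (by
      intro y hy
      rw [Finset.mem_insert] at hy ⊢
      rcases hy with rfl | hy
      · rintro (h | h)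
        · exact hx h
        · exact h₃ _ h (by simp)
      · rintro (h | h)
        · exact h₂ y hy h
        · exact hD y hy h)
    rw [Finset.card_insert_of_notMem h₁] at h
    omega
  have h := Finset.card_le_card hsub
  have h₁ := Finset.card_union_le (D ∪ D.image σ) (D.image σ.symm)
  have h₂ := Finset.card_union_le D (D.image σ)
  have h₃ : (D.image σ).card ≤ D.card := Finset.card_image_le
  have h₄ : (D.image σ.symm).card ≤ D.card := Finset.card_image_le
  omega

lemma card_invariant_sets_mul_le (σ : Equiv.Perm X) {D : Finset X} (hD : ∀ x ∈ D, σ x ∉ D) :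
    Nat.card {T : Set X // ∀ x, σ x ∈ T ↔ x ∈ T} * 2 ^ D.card ≤ 2 ^ Fintype.card X := by
  have hle : Nat.card {T : Set X // ∀ x, σ x ∈ T ↔ x ∈ T} ≤
      Nat.card (Set {x // x ∈ Dᶜ}) := by
    refine Nat.card_le_card_of_injective (fun T => {x | x.1 ∈ T.1}) ?_
    rintro ⟨T, hT⟩ ⟨U, hU⟩ h
    have key : ∀ x, x ∉ D → (x ∈ T ↔ x ∈ U) := fun x hx =>
      Set.ext_iff.1 h ⟨x, by simpa using hx⟩
    refine Subtype.ext (Set.ext fun x => ?_)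
    by_cases hx : x ∈ D
    · exact (hT x).symm.trans ((key _ (hD x hx)).trans (hU x))
    · exact key x hx
  calc _ ≤ Nat.card (Set {x // x ∈ Dᶜ}) * 2 ^ D.card := Nat.mul_le_mul_right _ hle
    _ = 2 ^ Fintype.card X := by
      rw [Nat.card_eq_fintype_card, Fintype.card_set, Fintype.card_coe, ← pow_add,
        Finset.card_compl_add_card]

end InvariantSets

section Counting

variable {G : Type*} [CommGroup G] [Fintype G]

noncomputable instance : Fintype (Hex G) := Fintype.ofFinite _

lemma two_mul_card_fixed_le [DecidableEq G] {f : G ≃* G} (hf : f ≠ MulEquiv.refl G) :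
    2 * (Finset.univ.filter fun x => f x = x).card ≤ Fintype.card G := by
  classical
  set H : Subgroup G := f.toMonoidHom.eqLocus (MonoidHom.id G) with hH
  have hcard : Nat.card H = (Finset.univ.filter fun x => f x = x).card := by
    rw [Nat.card_eq_fintype_card]
    exact Fintype.card_of_subtype _ (by intro x; simp [hH]; rfl)
  have hne : H.index ≠ 1 := by
    rw [Ne, Subgroup.index_eq_one]
    intro h
    refine hf (MulEquiv.ext fun x => ?_)
    have hx : x ∈ H := h ▸ Subgroup.mem_top x
    exact hx
  have h0 : H.index ≠ 0 := Subgroup.index_ne_zero_of_finite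
  have h := H.card_mul_index
  rw [hcard, Nat.card_eq_fintype_card] at h
  rw [← h, mul_comm]
  exact Nat.mul_le_mul_left _ (by omega)

lemma card_fixed_pairs_le [DecidableEq G] [DecidableEq (Hex G)] {f : G ≃* G}
    (hf : f ≠ MulEquiv.refl G) :
    4 * (Finset.univ.filter fun p : G × G =>
        hexPerm f (toHex (p.1, p.2, 1)) = toHex (p.1, p.2, 1)).card ≤
      Fintype.card G ^ 2 + 20 * Fintype.card G := by
  classical
  set F := Finset.univ.filter fun x => f x = x with hF
  let line (u : G → G × G) : Finset (G × G) := Finset.univ.image u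
  have hline : ∀ u, (line u).card ≤ Fintype.card G := fun u => Finset.card_image_le
  have hsub : (Finset.univ.filter fun p : G × G =>
        hexPerm f (toHex (p.1, p.2, 1)) = toHex (p.1, p.2, 1)) ⊆
      F ×ˢ F ∪ (line (fun x => (x, f x)) ∪ (line (fun x => (x, (f x)⁻¹ * x)) ∪
        (line (fun x => (x, (f x)⁻¹)) ∪ (line (fun x => (x, x * f x)) ∪
          line (fun y => ((f y)⁻¹ * y, y)))))) := by
    rintro ⟨x, y⟩ h
    have h' := (Finset.mem_filter.1 h).2.symm
    rw [hexPerm_toHex] at h'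
    rw [tripleMap] at h'
    simp only [map_one] at h'
    have hc := hexRel_one_cases (hexRel_of_toHex_eq h')
    simp only [Prod.mk.injEq] at hc
    simp only [Finset.mem_union, Finset.mem_product, hF, line, Finset.mem_filter, Finset.mem_univ,
      true_and, Finset.mem_image, Prod.mk.injEq, existsAndEq]
    rcases hc with ⟨h₁, h₂⟩ | ⟨h₁, h₂⟩ | ⟨h₁, h₂⟩ | ⟨h₁, h₂⟩ | ⟨h₁, h₂⟩ | ⟨h₁, h₂⟩
    · exact Or.inl ⟨h₁, h₂⟩
    · exact Or.inr (Or.inl h₁)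
    · exact Or.inr (Or.inr (Or.inl (by simp [h₁])))
    · exact Or.inr (Or.inr (Or.inr (Or.inl (by simp [h₁]))))
    · exact Or.inr (Or.inr (Or.inr (Or.inr (Or.inl (by simp [h₁])))))
    · exact Or.inr (Or.inr (Or.inr (Or.inr (Or.inr (by simp [h₂])))))
  have h := Finset.card_le_card hsub
  have h₁ := Finset.card_union_le (F ×ˢ F) (line (fun x => (x, f x)) ∪
    (line (fun x => (x, (f x)⁻¹ * x)) ∪ (line (fun x => (x, (f x)⁻¹)) ∪
      (line (fun x => (x, x * f x)) ∪ line (fun y => ((f y)⁻¹ * y, y))))))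
  have h₂ := Finset.card_union_le (line (fun x => (x, f x)))
    (line (fun x => (x, (f x)⁻¹ * x)) ∪ (line (fun x => (x, (f x)⁻¹)) ∪
      (line (fun x => (x, x * f x)) ∪ line (fun y => ((f y)⁻¹ * y, y)))))
  have h₃ := Finset.card_union_le (line (fun x => (x, (f x)⁻¹ * x)))
    (line (fun x => (x, (f x)⁻¹)) ∪
      (line (fun x => (x, x * f x)) ∪ line (fun y => ((f y)⁻¹ * y, y))))
  have h₄ := Finset.card_union_le (line (fun x => (x, (f x)⁻¹)))
      (line (fun x => (x, x * f x)) ∪ line (fun y => ((f y)⁻¹ * y, y)))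
  have h₅ := Finset.card_union_le (line (fun x => (x, x * f x)))
    (line (fun y => ((f y)⁻¹ * y, y)))
  have l₁ := hline (fun x => (x, f x))
  have l₂ := hline (fun x => (x, (f x)⁻¹ * x))
  have l₃ := hline (fun x => (x, (f x)⁻¹))
  have l₄ := hline (fun x => (x, x * f x))
  have l₅ := hline (fun y => ((f y)⁻¹ * y, y))
  have hFF : 4 * (F ×ˢ F).card ≤ Fintype.card G ^ 2 := by
    have := two_mul_card_fixed_le hf
    rw [Finset.card_product]
    nlinarith
  omega

omit [Fintype G] in
lemma card_pairs_le [DecidableEq (Hex G)] (s : Finset (G × G)) :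
    s.card ≤ 6 * (s.image fun p => toHex (p.1, p.2, 1)).card := by
  classical
  refine Finset.card_le_mul_card_image s 6 fun q hq => ?_
  obtain ⟨⟨a, b⟩, -, rfl⟩ := Finset.mem_image.1 hq
  refine (Finset.card_le_card (t := {(a, b), (b, a), (b⁻¹ * a, b⁻¹), (b⁻¹, b⁻¹ * a),
    (a⁻¹ * b, a⁻¹), (a⁻¹, a⁻¹ * b)}) ?_).trans Finset.card_le_six
  rintro ⟨x, y⟩ h
  have := hexRel_one_cases (hexRel_of_toHex_eq (Finset.mem_filter.1 h).2.symm)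
  simpa using this

lemma exists_disjoint_hexPerm {f : G ≃* G} (hf : f ≠ MulEquiv.refl G) :
    ∃ D : Finset (Hex G), (∀ q ∈ D, hexPerm f q ∉ D) ∧
      3 * Fintype.card G ^ 2 ≤ 72 * D.card + 20 * Fintype.card G := by
  classical
  obtain ⟨D, hD, hcard⟩ := exists_disjoint_image (hexPerm f)
  refine ⟨D, hD, ?_⟩
  have h₁ := card_fixed_pairs_le hf
  have h₂ := card_pairs_le (Finset.univ.filter fun p : G × G =>
        ¬ hexPerm f (toHex (p.1, p.2, 1)) = toHex (p.1, p.2, 1))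
  have h₃ : ((Finset.univ.filter fun p : G × G =>
        ¬ hexPerm f (toHex (p.1, p.2, 1)) = toHex (p.1, p.2, 1)).image
          fun p => toHex (p.1, p.2, 1)).card ≤
      (Finset.univ.filter fun q => hexPerm f q ≠ q).card := by
    refine Finset.card_le_card fun q hq => ?_
    obtain ⟨p, hp, rfl⟩ := Finset.mem_image.1 hq
    simpa using hp
  have h₄ := Finset.card_filter_add_card_filter_not (s := (Finset.univ : Finset (G × G)))
    (fun p => hexPerm f (toHex (p.1, p.2, 1)) = toHex (p.1, p.2, 1))
  rw [Finset.card_univ, Fintype.card_prod, ← sq] at h₄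
  omega

lemma card_invariant_symmetric_mul_le {f : G ≃* G} (hf : f ≠ MulEquiv.refl G) {m : ℕ}
    (hm : 72 * m + 20 * Fintype.card G ≤ 3 * Fintype.card G ^ 2) :
    Nat.card {S : Set (G × G × G) // IsSymmetric S ∧ tripleMap f '' S = S} * 2 ^ m ≤
      2 ^ Fintype.card (Hex G) := by
  classical
  obtain ⟨D, hD, hcard⟩ := exists_disjoint_hexPerm hf
  refine le_trans (Nat.mul_le_mul ?_ (Nat.pow_le_pow_right two_pos (by omega)))
    (card_invariant_sets_mul_le (hexPerm f) hD)
  have hinj : Function.Injective (tripleMap f) := by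
    rintro ⟨a, b, c⟩ ⟨x, y, z⟩ h
    simpa [tripleMap] using h
  refine Nat.card_le_card_of_injective (fun S => ⟨toHex '' S.1, fun q => ?_⟩) ?_
  · obtain ⟨v, rfl⟩ := toHex_surjective q
    rw [hexPerm_toHex, toHex_mem_image S.2.1, toHex_mem_image S.2.1]
    conv_lhs => rw [← S.2.2]
    exact hinj.mem_set_image
  · rintro ⟨S, hS, _⟩ ⟨T, hT, _⟩ h
    have h' : toHex '' S = toHex '' T := congrArg Subtype.val h
    refine Subtype.ext (Set.ext fun v => ?_)
    rw [← toHex_mem_image hS, ← toHex_mem_image hT, h']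

lemma card_mulEquiv_le : Nat.card (G ≃* G) ≤ Fintype.card G ^ Fintype.card G := by
  classical
  rw [← Fintype.card_fun, ← Nat.card_eq_fintype_card]
  exact Nat.card_le_card_of_injective _ (DFunLike.coe_injective (F := G ≃* G))

lemma numOrbits_invariant_mul_le (ε : G) (P : Set (G × G × G) → Prop) {m : ℕ}
    (hP : ∀ S, P S → IsSymmetric S ∧ ∃ f : G ≃* G, f ≠ MulEquiv.refl G ∧ tripleMap f '' S = S)
    (hm : 72 * m + 20 * Fintype.card G ≤ 3 * Fintype.card G ^ 2) :
    numOrbits ε P * 2 ^ m ≤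
      Fintype.card G ^ Fintype.card G * 2 ^ Fintype.card (Hex G) := by
  classical
  have h₁ : numOrbits ε P ≤ Nat.card {S // P S} :=
    Nat.card_le_card_of_surjective _ Quot.mk_surjective
  choose hsym f hne hfS using hP
  have h₂ : Nat.card {S // P S} ≤ Nat.card (Σ f : {f : G ≃* G // f ≠ MulEquiv.refl G},
      {S : Set (G × G × G) // IsSymmetric S ∧ tripleMap f.1 '' S = S}) := by
    refine Nat.card_le_card_of_injective
      (fun S => ⟨⟨f S.1 S.2, hne _ _⟩, ⟨S.1, hsym _ S.2, hfS _ _⟩⟩) ?_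
    rintro ⟨S, hS⟩ ⟨T, hT⟩ h
    have h' := congrArg (fun t : (Σ f : {f : G ≃* G // f ≠ MulEquiv.refl G},
      {S : Set (G × G × G) // IsSymmetric S ∧ tripleMap f.1 '' S = S}) => t.2.1) h
    exact Subtype.ext h'
  have : Fintype {f : G ≃* G // f ≠ MulEquiv.refl G} := Fintype.ofFinite _
  have h₃ : Fintype.card {f : G ≃* G // f ≠ MulEquiv.refl G} ≤
      Fintype.card G ^ Fintype.card G := by
    rw [← Nat.card_eq_fintype_card]
    exact (Nat.card_le_card_of_injective _ Subtype.val_injective).trans card_mulEquiv_le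
  calc numOrbits ε P * 2 ^ m
      ≤ (∑ f : {f : G ≃* G // f ≠ MulEquiv.refl G},
        Nat.card {S : Set (G × G × G) // IsSymmetric S ∧ tripleMap f.1 '' S = S}) * 2 ^ m := by
        rw [← Nat.card_sigma]
        exact Nat.mul_le_mul_right _ (h₁.trans h₂)
    _ ≤ ∑ _f : {f : G ≃* G // f ≠ MulEquiv.refl G}, 2 ^ Fintype.card (Hex G) := by
        rw [Finset.sum_mul]
        exact Finset.sum_le_sum fun f _ => card_invariant_symmetric_mul_le f.2 hm
    _ ≤ _ := by
        rw [Finset.sum_const, smul_eq_mul, Finset.card_univ]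
        exact Nat.mul_le_mul_right _ h₃

omit [Fintype G] in
lemma autRel_equivalence (ε : G) (P : Set (G × G × G) → Prop) : Equivalence (autRel ε P) := by
  refine ⟨fun S => ⟨MulEquiv.refl G, rfl, ?_⟩, ?_, ?_⟩
  · exact Set.image_id _
  · rintro S T ⟨f, hf, h⟩
    refine ⟨f.symm, by simp [MulEquiv.symm_apply_eq, hf], ?_⟩
    rw [← h, Set.image_image]
    simp [tripleMap]
  · rintro S T U ⟨f, hf, h⟩ ⟨g, hg, h'⟩
    refine ⟨f.trans g, by simp [hf, hg], ?_⟩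
    rw [← h', ← h, Set.image_image]
    rfl

lemma card_le_mul_numOrbits (ε : G) (P : Set (G × G × G) → Prop) :
    Nat.card {S // P S} ≤ Fintype.card G ^ Fintype.card G * numOrbits ε P := by
  have hex : ∀ S : {S // P S}, ∃ f : G ≃* G,
      tripleMap f '' (Quot.mk (autRel ε P) S).out.1 = S.1 := by
    intro S
    have h : Quot.mk (autRel ε P) (Quot.mk (autRel ε P) S).out = Quot.mk (autRel ε P) S :=
      Quot.out_eq _
    rw [Quot.eq, (autRel_equivalence ε P).eqvGen_iff] at h
    obtain ⟨f, -, hf⟩ := h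
    exact ⟨f, hf⟩
  choose f hf using hex
  refine le_trans ?_ (Nat.mul_le_mul_right (numOrbits ε P) (card_mulEquiv_le (G := G)))
  rw [numOrbits, ← Nat.card_prod]
  refine Nat.card_le_card_of_injective (fun S => (f S, Quot.mk (autRel ε P) S)) ?_
  intro S T h
  rw [Prod.mk.injEq] at h
  refine Subtype.ext ?_
  rw [← hf S, ← hf T, h.1, h.2]

open scoped Pointwise in
lemma exists_small_mul_self_eq_univ [DecidableEq G] {k : ℕ} (hk : 0 < k)
    (hkn : k ≤ Fintype.card G) :
    ∃ D : Finset G, (∀ g, ∃ a ∈ D, ∃ b ∈ D, a * b = g) ∧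
      (D.card : ℝ) ≤ Fintype.card G / k + k ^ 2 := by
  obtain ⟨B, -, hB⟩ := Finset.exists_subset_card_eq (s := (Finset.univ : Finset G)) (n := k)
    (by simpa using hkn)
  have hBne : B.Nonempty := Finset.card_pos.1 (by omega)
  have hk' : (0 : ℝ) < k := by exact_mod_cast hk
  obtain ⟨F, -, hF, hcover⟩ := Finset.ruzsa_covering_mul (A := (Finset.univ : Finset G))
    (K := (Fintype.card G / k : ℝ)) hBne (by
      rw [hB, div_mul_cancel₀ _ hk'.ne']
      exact_mod_cast Finset.card_le_univ _)
  refine ⟨F ∪ B / B, fun g => ?_, ?_⟩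
  · obtain ⟨a, ha, b, hb, hab⟩ := Finset.mem_mul.1 (hcover (Finset.mem_univ g))
    exact ⟨a, Finset.mem_union_left _ ha, b, Finset.mem_union_right _ hb, hab⟩
  · have h₁ := Finset.card_union_le F (B / B)
    have h₂ := Finset.card_div_le (s := B) (t := B)
    rw [hB] at h₂
    have h₃ : ((F ∪ B / B).card : ℝ) ≤ F.card + k * k := by exact_mod_cast h₁.trans (by omega)
    nlinarith

omit [Fintype G] in
lemma condA_of_forall_mem (ε : G) {D : Finset G} (hD : ∀ g, ∃ a ∈ D, ∃ b ∈ D, a * b = g)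
    {S : Set (G × G × G)} (hDS : ∀ x, ∀ d ∈ D, (x, d, 1) ∈ S) : CondA ε S := by
  obtain ⟨d, hd, -⟩ := hD 1
  exact fun x _ => ⟨d, hDS x d hd⟩

omit [Fintype G] in
lemma condB_of_forall_mem (ε : G) {D : Finset G} (hD : ∀ g, ∃ a ∈ D, ∃ b ∈ D, a * b = g)
    {S : Set (G × G × G)} (hS : IsSymmetric S) (hDS : ∀ x, ∀ d ∈ D, (x, d, 1) ∈ S) :
    CondB ε S := by
  intro x y z w _ _ _
  obtain ⟨a, ha, b, hb, hab⟩ := hD (x⁻¹ * w)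
  refine ⟨(x * a)⁻¹, ?_, ?_⟩
  · have h := hS.2.2 a⁻¹ _ _ _ (hDS (a * (ε * (x * a)⁻¹ * z)) a ha)
    have h' := hS.2.1 _ _ _ (hS.2.1 _ _ _ h)
    convert h' using 2 <;> simp
  · convert hDS (ε * (x * a)⁻¹ * y) b hb using 3
    rw [mul_inv, mul_right_comm, ← hab]
    simp

lemma two_pow_le_mul_numOrbits (ε : G) {D : Finset G}
    (hD : ∀ g, ∃ a ∈ D, ∃ b ∈ D, a * b = g) :
    2 ^ Fintype.card (Hex G) ≤ 2 ^ (Fintype.card G * D.card) *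
      (Fintype.card G ^ Fintype.card G *
        numOrbits ε (fun S => IsSymmetric S ∧ CondA ε S ∧ CondB ε S)) := by
  classical
  set F : Finset (Hex G) := ((Finset.univ : Finset G) ×ˢ D).image fun p => toHex (p.1, p.2, 1)
    with hF
  have hFcard : F.card ≤ Fintype.card G * D.card := by
    refine Finset.card_image_le.trans ?_
    rw [Finset.card_product, Finset.card_univ]
  have hle : Nat.card (Set {q // q ∈ Fᶜ}) ≤
      Nat.card {S : Set (G × G × G) // IsSymmetric S ∧ CondA ε S ∧ CondB ε S} := by
    have hmem : ∀ (T : Set {q // q ∈ Fᶜ}) (x : G), ∀ d ∈ D,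
        (x, d, 1) ∈ toHex ⁻¹' (Subtype.val '' T ∪ (F : Set (Hex G))) := fun T x d hd =>
      Or.inr (Finset.mem_coe.2 (Finset.mem_image.2 ⟨(x, d), by simpa using hd, rfl⟩))
    refine Nat.card_le_card_of_injective (fun T => ⟨toHex ⁻¹' (Subtype.val '' T ∪ F),
      isSymmetric_preimage _, condA_of_forall_mem ε hD (hmem T),
      condB_of_forall_mem ε hD (isSymmetric_preimage _) (hmem T)⟩) ?_
    intro T U h
    have h' := toHex_surjective.preimage_injective (congrArg Subtype.val h)
    ext ⟨q, hq⟩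
    have hq' : q ∉ F := by simpa using hq
    have := Set.ext_iff.1 h' q
    simpa [hq'] using this
  rw [Nat.card_eq_fintype_card, Fintype.card_set, Fintype.card_coe] at hle
  calc 2 ^ Fintype.card (Hex G) = 2 ^ F.card * 2 ^ Fᶜ.card := by
        rw [← pow_add, Finset.card_add_card_compl]
    _ ≤ _ := Nat.mul_le_mul (Nat.pow_le_pow_right two_pos hFcard)
        (hle.trans (card_le_mul_numOrbits ε _))

end Counting

/-- there are `c > 0` and `N₀` such that for every finite abelian group `G`
of order `n ≥ N₀` and every `ε ∈ G` with `ε² = 1`, the number of `Aut(G, ε)`-orbits of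
symmetric hyperfield-defining subsets fixed setwise by some non-identity `ε`-preserving
automorphism is at most `e^{-cn²}` times the number of `Aut(G, ε)`-orbits of all
symmetric hyperfield-defining subsets. -/
theorem stmt17 :
    ∃ c : ℝ, 0 < c ∧ ∃ N₀ : ℕ, ∀ (G : Type) [CommGroup G] [Fintype G],
      N₀ ≤ Fintype.card G → ∀ ε : G, ε ^ 2 = 1 →
      (numOrbits ε (fun S => IsSymmetric S ∧ CondA ε S ∧ CondB ε S ∧
          ∃ f : G ≃* G, f ≠ MulEquiv.refl G ∧ f ε = ε ∧ tripleMap f '' S = S) : ℝ) ≤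
        Real.exp (-(c * (Fintype.card G : ℝ) ^ 2)) *
          (numOrbits ε (fun S => IsSymmetric S ∧ CondA ε S ∧ CondB ε S) : ℝ) := by
  obtain ⟨N₁, hN₁⟩ := Filter.eventually_atTop.1
    ((Real.isLittleO_log_id_atTop.bound (show (0 : ℝ) < 1 / 1000 by norm_num)).natCast_atTop)
  refine ⟨1 / 1000, by norm_num, max N₁ 1000000, fun G _ _ hn ε _ => ?_⟩
  classical
  have hlog := hN₁ _ (le_of_max_le_left hn)
  have hbig := le_of_max_le_right hn
  set P : Set (G × G × G) → Prop := fun S => IsSymmetric S ∧ CondA ε S ∧ CondB ε S ∧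
    ∃ f : G ≃* G, f ≠ MulEquiv.refl G ∧ f ε = ε ∧ tripleMap f '' S = S with hP
  set Q : Set (G × G × G) → Prop := fun S => IsSymmetric S ∧ CondA ε S ∧ CondB ε S with hQ
  obtain ⟨D, hD, hDcard⟩ := exists_small_mul_self_eq_univ (G := G) (k := 48) (by norm_num)
    (by omega)
  have hall := two_pow_le_mul_numOrbits ε hD
  rw [← hQ] at hall
  generalize hcard : Fintype.card G = n at *
  obtain ⟨m, hm, hm'⟩ : ∃ m : ℕ, 72 * m + 20 * n ≤ 3 * n ^ 2 ∧
      3 * n ^ 2 ≤ 72 * (m + 1) + 20 * n := by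
    have : 20 * n ≤ 3 * n ^ 2 := by nlinarith
    exact ⟨(3 * n ^ 2 - 20 * n) / 72, by omega, by omega⟩
  have hfix := numOrbits_invariant_mul_le ε P
    (fun S hS => ⟨hS.1, hS.2.2.2.imp fun f hf => ⟨hf.1, hf.2.2⟩⟩) (by rw [hcard]; exact hm)
  rw [hcard] at hfix
  have hcomb : numOrbits ε P * 2 ^ m ≤ n ^ (2 * n) * 2 ^ (n * D.card) * numOrbits ε Q := by
    refine (hfix.trans (Nat.mul_le_mul_left _ hall)).trans (le_of_eq ?_)
    ring
  have hn0 : (1000000 : ℝ) ≤ n := by exact_mod_cast hbig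
  have hnpos : (0 : ℝ) < n := by linarith
  have hcombR : (numOrbits ε P : ℝ) * 2 ^ m ≤
      (n : ℝ) ^ (2 * n) * 2 ^ (n * D.card) * numOrbits ε Q := by exact_mod_cast hcomb
  have hmR : 3 * (n : ℝ) ^ 2 ≤ 72 * (m + 1) + 20 * n := by exact_mod_cast hm'
  have hlog' : Real.log n ≤ 1 / 1000 * n := by
    have h := (le_abs_self _).trans hlog
    simpa [abs_of_pos hnpos] using h
  have hpow2 : ∀ j : ℕ, (2 : ℝ) ^ j = Real.exp (j * Real.log 2) := fun j => by
    rw [Real.exp_nat_mul, Real.exp_log two_pos]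
  have hpown : (n : ℝ) ^ (2 * n) = Real.exp (2 * n * Real.log n) := by
    have h := Real.exp_nat_mul (Real.log n) (2 * n)
    rw [Real.exp_log hnpos] at h
    rw [← h]
    push_cast
    rfl
  rw [hpow2, hpow2, hpown, ← Real.exp_add] at hcombR
  have hexp : 2 * n * Real.log n + ((n * D.card : ℕ) : ℝ) * Real.log 2 ≤
      -(1 / 1000 * (n : ℝ) ^ 2) + m * Real.log 2 := by
    push_cast at hDcard ⊢
    have hl₁ := Real.log_two_gt_d9
    have h₁ : (n : ℝ) * D.card ≤ n * (n / 48 + 48 ^ 2) :=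
      mul_le_mul_of_nonneg_left hDcard hnpos.le
    have h₂ : 2 * n * Real.log n ≤ 2 * n * (1 / 1000 * n) :=
      mul_le_mul_of_nonneg_left hlog' (by positivity)
    have h₃ : (1 / 100 : ℝ) * n ^ 2 ≤ m - n * D.card := by nlinarith
    have h₄ : (1 / 100 : ℝ) * n ^ 2 * (1 / 2) ≤ (m - n * D.card) * Real.log 2 :=
      mul_le_mul h₃ (by linarith) (by norm_num) ((by positivity : (0 : ℝ) ≤ _).trans h₃)
    nlinarith
  have h := hcombR.trans
    (mul_le_mul_of_nonneg_right (Real.exp_le_exp.2 hexp) (Nat.cast_nonneg _))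
  rw [Real.exp_add, mul_right_comm] at h
  exact le_of_mul_le_mul_right h (Real.exp_pos _)
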